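/- Let G be a connected bipartite graph on n vertices whose binomial edge ideal J_G is Cohen-Macaulay, characterized combinatorially by: J_G is unmixed (c_G(S) = |S| + 1 for all cut sets S) and every nonempty cut set S contains an element s with S \ {s} again a cut set. Then every cut set S of G satisfies |S| ≤ ⌈n/2⌉ − 1, and the diameter of the dual graph of J_G is at most n − 1 = ht(J_G), i.e., J_G is Hirsch. -/

import Mathlib

open SimpleGraph Finset

/-- Number of connected components of the subgraph of `G` induced on the complement of `S`. -/
noncomputable def numComp {V : Type*} [Fintype V] (G : SimpleGraph V) (S : Finset V) : ℕ :=
  Nat.card (G.induce ((↑S : Set V)ᶜ)).ConnectedComponent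

/-- `S` is a cut set of `G`. -/
def IsCutSet {V : Type*} [Fintype V] [DecidableEq V] (G : SimpleGraph V) (S : Finset V) : Prop :=
  S = ∅ ∨ (S ≠ ∅ ∧ ∀ i ∈ S, numComp G (S.erase i) < numComp G S)

/-- The combinatorial condition equivalent to unmixedness of the binomial edge ideal. -/
def Unmixed {V : Type*} [Fintype V] [DecidableEq V] (G : SimpleGraph V) : Prop :=
  ∀ S : Finset V, IsCutSet G S → numComp G S = S.card + 1

open MvPolynomial in
/-- The prime ideal `P_S(G)` in `R = K[x_1, ..., x_n, y_1, ..., y_n]`: it is generated by the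
variables `x_i, y_i` for `i ∈ S` together with the `2`-minors `x_i y_j - x_j y_i` for all
pairs `i, j` lying in a common connected component of `G` restricted to the complement of `S`
(these generate the binomial edge ideals of the complete graphs on the components). -/
noncomputable def PSIdeal {n : ℕ} (K : Type*) [Field K] (G : SimpleGraph (Fin n))
    (S : Finset (Fin n)) : Ideal (MvPolynomial (Fin n ⊕ Fin n) K) :=
  Ideal.span
    ((fun i => (X (Sum.inl i) : MvPolynomial (Fin n ⊕ Fin n) K)) '' (↑S : Set (Fin n)) ∪
     (fun i => (X (Sum.inr i) : MvPolynomial (Fin n ⊕ Fin n) K)) '' (↑S : Set (Fin n)) ∪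
     {p | ∃ i j : Fin n,
        (∃ (hi : i ∈ ((↑S : Set (Fin n))ᶜ)) (hj : j ∈ ((↑S : Set (Fin n))ᶜ)),
          (G.induce ((↑S : Set (Fin n))ᶜ)).Reachable ⟨i, hi⟩ ⟨j, hj⟩) ∧
        p = X (Sum.inl i) * X (Sum.inr j) - X (Sum.inl j) * X (Sum.inr i)})

/-- The height of an ideal: the infimum of the heights (in the prime spectrum) of the
prime ideals containing it. -/
noncomputable def heightIdeal {R : Type*} [CommRing R] (I : Ideal R) : ℕ∞ :=
  ⨅ (p : PrimeSpectrum R) (_ : I ≤ p.asIdeal), Order.height p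

/-- The dual graph of the binomial edge ideal `J_G`: vertices are the minimal primes,
indexed by the cut sets of `G`, and `P_S`, `P_T` are adjacent when
`ht(P_S + P_T) = ht(J_G) + 1 = n`. -/
noncomputable def dualGraph {n : ℕ} (K : Type*) [Field K] (G : SimpleGraph (Fin n)) :
    SimpleGraph {S : Finset (Fin n) // IsCutSet G S} :=
  SimpleGraph.fromRel (fun S T =>
    heightIdeal (PSIdeal K G S.1 + PSIdeal K G T.1) = (n : ℕ∞))


section Helpers

open MvPolynomial

variable {V : Type*} {K : Type*} [Field K]

/-- The 2-minor. -/
noncomputable def minorXY (K : Type*) [Field K] {V : Type*} (i j : V) : MvPolynomial (V ⊕ V) K :=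
  X (Sum.inl i) * X (Sum.inr j) - X (Sum.inl j) * X (Sum.inr i)

open Classical in
/-- The map evaluating the variables in `U` modulo `p`. -/
noncomputable def phiU {σ : Type*} (p : Ideal (MvPolynomial σ K)) (U : Set σ) :
    MvPolynomial σ K →ₐ[K] MvPolynomial σ (MvPolynomial σ K ⧸ p) :=
  aeval (fun i => if i ∈ U then C (Ideal.Quotient.mk p (X i)) else X i)

lemma phiU_mem {σ : Type*} (p : Ideal (MvPolynomial σ K)) (U : Set σ) {i : σ} (h : i ∈ U) :
    phiU p U (X i) = C (Ideal.Quotient.mk p (X i)) := by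
  simp [phiU, h]

lemma phiU_not_mem {σ : Type*} (p : Ideal (MvPolynomial σ K)) (U : Set σ) {i : σ} (h : i ∉ U) :
    phiU p U (X i) = X i := by
  simp [phiU, h]

/-- The prime `Q_U`. -/
noncomputable def QU {σ : Type*} (p : Ideal (MvPolynomial σ K)) [p.IsPrime] (U : Set σ) :
    PrimeSpectrum (MvPolynomial σ K) :=
  ⟨RingHom.ker (phiU p U), RingHom.ker_isPrime _⟩

lemma QU_mono {σ : Type*} (p : Ideal (MvPolynomial σ K)) [p.IsPrime] {U U' : Set σ}
    (h : U ⊆ U') : QU p U ≤ QU p U' := by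
  classical
  let ψ : MvPolynomial σ (MvPolynomial σ K ⧸ p) →ₐ[MvPolynomial σ K ⧸ p]
      MvPolynomial σ (MvPolynomial σ K ⧸ p) :=
    aeval (fun i => if i ∈ U' then C (Ideal.Quotient.mk p (X i)) else X i)
  have key : (ψ.restrictScalars K).comp (phiU p U) = phiU p U' := by
    apply MvPolynomial.algHom_ext
    intro i
    by_cases hi : i ∈ U
    · simp only [AlgHom.comp_apply, phiU_mem p U hi, phiU_mem p U' (h hi)]
      simp [ψ, MvPolynomial.algebraMap_eq]
    · simp only [AlgHom.comp_apply, phiU_not_mem p U hi]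
      simp [ψ, phiU]
  intro f hf
  change phiU p U f = 0 at hf
  change phiU p U' f = 0
  rw [← key, AlgHom.comp_apply, hf, map_zero]

lemma QU_univ {σ : Type*} (p : Ideal (MvPolynomial σ K)) [hp : p.IsPrime] :
    QU p Set.univ = ⟨p, hp⟩ := by
  have key : ∀ f, phiU p Set.univ f = C (Ideal.Quotient.mk p f) := by
    intro f
    have : phiU p Set.univ =
        (Algebra.ofId (MvPolynomial σ K ⧸ p) (MvPolynomial σ (MvPolynomial σ K ⧸ p))
          |>.restrictScalars K).comp (Ideal.Quotient.mkₐ K p) := by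
      apply MvPolynomial.algHom_ext
      intro i
      rw [phiU_mem p _ (Set.mem_univ i)]
      rfl
    rw [this]; rfl
  ext f
  change phiU p Set.univ f = 0 ↔ f ∈ p
  rw [key, map_eq_zero_iff _ (C_injective _ _), Ideal.Quotient.eq_zero_iff_mem]

lemma QU_insert_of_mem {σ : Type*} (p : Ideal (MvPolynomial σ K)) [hp : p.IsPrime] {U U' : Set σ}
    (h : U ⊆ U') (i : σ) (hi : i ∉ U) (hi' : i ∈ U') (hX : X i ∈ p) :
    Order.height (QU p U) + 1 ≤ Order.height (QU p U') := by
  apply Order.height_add_one_le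
  refine lt_of_le_of_ne (QU_mono p h) ?_
  intro he
  have h1 : (X i : MvPolynomial σ K) ∈ (QU p U').asIdeal := by
    change phiU p U' (X i) = 0
    rw [phiU_mem p U' hi', Ideal.Quotient.eq_zero_iff_mem.mpr hX, map_zero]
  rw [← he] at h1
  change phiU p U (X i) = 0 at h1
  rw [phiU_not_mem p U hi] at h1
  exact X_ne_zero i h1

/-- Relation `a * X i - b` with `a ∉ p`, where `a`, `b` are products of variables. -/
lemma QU_insert_of_rel {σ : Type*} (p : Ideal (MvPolynomial σ K)) [hp : p.IsPrime] {U U' : Set σ}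
    (h : U ⊆ U') (i a b c : σ) (hi : i ∉ U) (hi' : i ∈ U') (ha : a ∈ U) (hb : b ∈ U) (hc : c ∈ U)
    (haX : X a ∉ p) (hX : X a * X i - X b * X c ∈ p) :
    Order.height (QU p U) + 1 ≤ Order.height (QU p U') := by
  apply Order.height_add_one_le
  refine lt_of_le_of_ne (QU_mono p h) ?_
  intro he
  have h1 : (X a * X i - X b * X c : MvPolynomial σ K) ∈ (QU p U').asIdeal := by
    change phiU p U' (X a * X i - X b * X c) = 0
    simp only [map_sub, map_mul]
    rw [phiU_mem p U' hi', phiU_mem p U' (h ha), phiU_mem p U' (h hb), phiU_mem p U' (h hc),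
      ← C_mul, ← C_mul, ← C_sub, ← map_mul, ← map_mul, ← map_sub,
      Ideal.Quotient.eq_zero_iff_mem.mpr hX, map_zero]
  rw [← he] at h1
  change phiU p U (X a * X i - X b * X c) = 0 at h1
  simp only [map_sub, map_mul] at h1
  rw [phiU_not_mem p U hi, phiU_mem p U ha, phiU_mem p U hb, phiU_mem p U hc, ← map_mul] at h1
  classical
  have h2 := congrArg (MvPolynomial.coeff (Finsupp.single i 1)) h1
  rw [coeff_sub, coeff_C_mul, coeff_X, coeff_C] at h2
  have h3 : (0 : σ →₀ ℕ) ≠ Finsupp.single i 1 := by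
    intro h; have := DFunLike.congr_fun h i; simp at this
  simp only [if_neg h3, coeff_zero, sub_zero, if_true, mul_one] at h2
  exact haX (Ideal.Quotient.eq_zero_iff_mem.mp h2)

/-- The variables attached to a set of vertices. -/
def varsOf (W : Set V) : Set (V ⊕ V) := {z | Sum.elim id id z ∈ W}

lemma lower_bound [Nonempty V] [Fintype V] [DecidableEq V] {γ : Type*} [Fintype γ]
    (p : Ideal (MvPolynomial (V ⊕ V) K)) [hp : p.IsPrime] (T : Finset V) (c : V → γ)
    (hT : ∀ t ∈ T, X (Sum.inl t) ∈ p ∧ X (Sum.inr t) ∈ p)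
    (hm : ∀ i j, i ∉ T → j ∉ T → c i = c j → minorXY K i j ∈ p) :
    ((Fintype.card V + T.card : ℕ) : ℕ∞) ≤
      Order.height (⟨p, hp⟩ : PrimeSpectrum _) + (Fintype.card γ : ℕ) := by
  classical
  let good : V → Prop := fun v => ¬ (X (Sum.inl v) ∈ p ∧ X (Sum.inr v) ∈ p)
  have hgT : ∀ v, good v → v ∉ T := fun v hv ht => hv (hT v ht)
  let Γ : Finset γ := Finset.univ.filter (fun g => ∃ v, good v ∧ c v = g)
  have hch : ∀ g : γ, ∃ v : V, g ∈ Γ → good v ∧ c v = g := by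
    intro g
    by_cases hg : g ∈ Γ
    · obtain ⟨v, hv⟩ := (Finset.mem_filter.mp hg).2
      exact ⟨v, fun _ => hv⟩
    · exact ⟨Classical.arbitrary V, fun h => absurd h hg⟩
  choose b hb using hch
  let B : Finset V := Γ.image b
  have hBcard : B.card ≤ Fintype.card γ := Finset.card_image_le.trans (Finset.card_le_univ _)
  have main : ∀ W : Finset V, Disjoint B W →
      ((W.card + (W ∩ T).card : ℕ) : ℕ∞) ≤
        Order.height (QU p (varsOf ((B ∪ W : Finset V) : Set V))) := by
    intro W
    induction W using Finset.induction_on with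
    | empty => intro _; simp
    | insert v W hv ih =>
      intro hd
      rw [Finset.disjoint_insert_right] at hd
      have ih := ih hd.2
      set U := varsOf ((B ∪ W : Finset V) : Set V) with hU
      set U' := varsOf ((B ∪ insert v W : Finset V) : Set V) with hU'
      have hvU : v ∉ B ∪ W := by simp [hd.1, hv]
      have hl : Sum.inl v ∉ U := by simpa [hU, varsOf] using hvU
      have hr : Sum.inr v ∉ U := by simpa [hU, varsOf] using hvU
      have hl' : Sum.inl v ∈ U' := by simp [hU', varsOf]
      have hr' : Sum.inr v ∈ U' := by simp [hU', varsOf]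
      set U1 := insert (Sum.inl v) U with hU1
      have h01 : U ⊆ U1 := Set.subset_insert _ _
      have h02 : U ⊆ U' := by
        intro z hz
        simp only [hU, hU', varsOf, Finset.coe_union, Finset.coe_insert, Set.mem_ofPred_eq,
          Set.mem_union, Set.mem_insert_iff] at hz ⊢
        tauto
      have h12 : U1 ⊆ U' := Set.insert_subset hl' h02
      have hr1 : Sum.inr v ∉ U1 := by simp [hU1, hr]
      by_cases hg : good v
      · have hvT := hgT v hg
        have hΓ : c v ∈ Γ := by simp only [Γ, Finset.mem_filter]; exact ⟨Finset.mem_univ _, v, hg, rfl⟩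
        obtain ⟨hb1, hb2⟩ := hb _ hΓ
        have hbB : b (c v) ∈ B := Finset.mem_image_of_mem _ hΓ
        have hbl : Sum.inl (b (c v)) ∈ U := by simp [hU, varsOf, hbB]
        have hbr : Sum.inr (b (c v)) ∈ U := by simp [hU, varsOf, hbB]
        have hmin := hm (b (c v)) v (hgT _ hb1) hvT hb2
        have step : Order.height (QU p U) + 1 ≤ Order.height (QU p U') := by
          by_cases hx : X (Sum.inl (b (c v))) ∈ p
          · have hy : X (Sum.inr (b (c v))) ∉ p := fun hy => hb1 ⟨hx, hy⟩
            have : X (Sum.inl v) * X (Sum.inr (b (c v))) ∈ p := by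
              have := p.sub_mem (p.mul_mem_right (X (Sum.inr v)) hx) hmin
              simpa [minorXY] using this
            have hxv := (hp.mem_or_mem this).resolve_right hy
            exact QU_insert_of_mem p h02 _ hl hl' hxv
          · refine le_trans (add_le_add_left (Order.height_mono (QU_mono p h01)) 1) ?_
            exact QU_insert_of_rel p h12 (Sum.inr v) (Sum.inl (b (c v))) (Sum.inl v)
              (Sum.inr (b (c v))) hr1 hr' (h01 hbl) (Set.mem_insert _ _) (h01 hbr) hx hmin
        refine le_trans ?_ step
        refine le_trans ?_ (add_le_add_left ih 1)
        rw [Finset.card_insert_of_notMem hv, Finset.insert_inter_of_notMem hvT]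
        norm_cast
        omega
      · have hg' := not_not.mp hg
        have s1 := QU_insert_of_mem p h01 _ hl (Set.mem_insert _ _) hg'.1
        have s2 := QU_insert_of_mem p h12 _ hr1 hr' hg'.2
        refine le_trans ?_ s2
        refine le_trans ?_ (add_le_add_left s1 1)
        refine le_trans ?_ (add_le_add_left (add_le_add_left ih 1) 1)
        have : (insert v W ∩ T).card ≤ (W ∩ T).card + 1 := by
          refine (Finset.card_le_card (t := insert v (W ∩ T)) ?_).trans (Finset.card_insert_le _ _)
          intro z; simp; tauto
        rw [Finset.card_insert_of_notMem hv]
        norm_cast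
        omega
  have hfin := main Bᶜ disjoint_compl_right
  have hu : varsOf ((B ∪ Bᶜ : Finset V) : Set V) = Set.univ := by
    ext z; simp [varsOf]
  rw [hu, QU_univ] at hfin
  refine le_trans ?_ (add_le_add_left hfin _)
  have hTB : Bᶜ ∩ T = T := by
    rw [Finset.inter_eq_right]
    intro t ht
    rw [Finset.mem_compl]
    intro hB
    obtain ⟨g, hg, rfl⟩ := Finset.mem_image.mp hB
    exact hgT _ (hb g hg).1 ht
  rw [hTB, Finset.card_compl]
  norm_cast
  have := Finset.card_le_univ B
  omega

lemma upper_bound [Fintype V] [DecidableEq V] {γ : Type*} [Fintype γ]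
    (T : Finset V) (c : V → γ) (b : γ → V) (hb : ∀ g, b g ∉ T ∧ c (b g) = g) :
    ∃ q : PrimeSpectrum (MvPolynomial (V ⊕ V) K),
      (∀ t ∈ T, X (Sum.inl t) ∈ q.asIdeal ∧ X (Sum.inr t) ∈ q.asIdeal) ∧
      (∀ i j, i ∉ T → j ∉ T → c i = c j → minorXY K i j ∈ q.asIdeal) ∧
      Order.height q + (Fintype.card γ : ℕ) ≤ ((Fintype.card V + T.card : ℕ) : ℕ∞) := by
  classical
  let B : Finset V := Finset.univ.image b
  have hbinj : Function.Injective b := fun g g' h => by rw [← (hb g).2, ← (hb g').2, h]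
  have hB : B.card = Fintype.card γ := by
    rw [Finset.card_image_of_injective _ hbinj, Finset.card_univ]
  let s : Finset (MvPolynomial (V ⊕ V) K) :=
    T.image (fun t => X (Sum.inl t)) ∪ T.image (fun t => X (Sum.inr t)) ∪
      (T ∪ B)ᶜ.image (fun j => minorXY K (b (c j)) j)
  have hTB : Disjoint T B := by
    rw [Finset.disjoint_right]
    intro v hv
    obtain ⟨g, -, rfl⟩ := Finset.mem_image.mp hv
    exact (hb g).1
  have hs : s.card + Fintype.card γ ≤ Fintype.card V + T.card := by
    have h1 : s.card ≤ T.card + T.card + (T ∪ B)ᶜ.card :=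
      (Finset.card_union_le _ _).trans (add_le_add ((Finset.card_union_le _ _).trans
        (add_le_add Finset.card_image_le Finset.card_image_le)) Finset.card_image_le)
    have h2 := Finset.card_add_card_compl (T ∪ B)
    rw [Finset.card_union_of_disjoint hTB] at h2
    omega
  let ev : MvPolynomial (V ⊕ V) K →ₐ[K] K :=
    aeval (Sum.elim (fun v => if v ∈ T then (0 : K) else 1) (fun _ => 0))
  have hev : Ideal.span (s : Set (MvPolynomial (V ⊕ V) K)) ≤ RingHom.ker ev := by
    rw [Ideal.span_le]
    intro f hf
    simp only [s, Finset.coe_union, Finset.coe_image, Set.mem_union, Set.mem_image] at hf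
    rw [SetLike.mem_coe, RingHom.mem_ker]
    rcases hf with (⟨t, ht, rfl⟩ | ⟨t, ht, rfl⟩) | ⟨t, ht, rfl⟩
    · have : t ∈ T := ht
      simp [ev, this]
    · simp [ev]
    · simp [ev, minorXY]
  have : (RingHom.ker ev).IsPrime := RingHom.ker_isPrime _
  obtain ⟨q, hq, hqm⟩ := Ideal.exists_minimalPrimes_le hev
  have hqp : q.IsPrime := hq.isPrime
  have hle : Ideal.span (s : Set (MvPolynomial (V ⊕ V) K)) ≤ q := hq.1.2
  have hsq : ∀ f ∈ s, f ∈ q := fun f hf => hle (Ideal.subset_span hf)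
  have hx : ∀ v, v ∉ T → X (Sum.inl v) ∉ q := by
    intro v hv hmem
    have := hqm hmem
    rw [RingHom.mem_ker] at this
    simp [ev, hv] at this
  have hbase : ∀ j, j ∉ T → minorXY K (b (c j)) j ∈ q := by
    intro j hj
    by_cases hjB : j ∈ B
    · obtain ⟨g, -, rfl⟩ := Finset.mem_image.mp hjB
      rw [(hb g).2]
      simp [minorXY]
    · apply hsq
      apply Finset.mem_union_right
      apply Finset.mem_image_of_mem (fun j => minorXY K (b (c j)) j)
      simp [hj, hjB]
  refine ⟨⟨q, hqp⟩, ?_, ?_, ?_⟩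
  · intro t ht
    constructor
    · apply hsq; apply Finset.mem_union_left; apply Finset.mem_union_left
      exact Finset.mem_image_of_mem (fun t => X (Sum.inl t)) ht
    · apply hsq; apply Finset.mem_union_left; apply Finset.mem_union_right
      exact Finset.mem_image_of_mem (fun t => X (Sum.inr t)) ht
  · intro i j hi hj hij
    have h1 := hbase i hi
    have h2 := hbase j hj
    rw [hij] at h1
    have h3 : X (Sum.inl (b (c j))) * minorXY K i j ∈ q := by
      have : X (Sum.inl (b (c j))) * minorXY K i j =
          X (Sum.inl i) * minorXY K (b (c j)) j - X (Sum.inl j) * minorXY K (b (c j)) i := by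
        simp only [minorXY]; ring
      rw [this]
      exact q.sub_mem (q.mul_mem_left _ h2) (q.mul_mem_left _ h1)
    exact (hqp.mem_or_mem h3).resolve_left (hx _ (hb _).1)
  · have h1 := Ideal.height_le_card_of_mem_minimalPrimes_span_finset hq
    have h2 : Order.height (⟨q, hqp⟩ : PrimeSpectrum (MvPolynomial (V ⊕ V) K)) = q.height :=
      (PrimeSpectrum.height_eq_orderHeight ⟨q, hqp⟩).symm
    rw [h2]
    refine le_trans (add_le_add_left h1 _) ?_
    exact_mod_cast hs

end Helpers


lemma reach_mono {V : Type*} [Fintype V] (G : SimpleGraph V) {S T : Finset V} (h : S ⊆ T)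
    {a b : V} (ha : a ∈ ((↑T : Set V)ᶜ)) (hb : b ∈ ((↑T : Set V)ᶜ))
    (hr : (G.induce ((↑T : Set V)ᶜ)).Reachable ⟨a, ha⟩ ⟨b, hb⟩) :
    (G.induce ((↑S : Set V)ᶜ)).Reachable ⟨a, fun h' => ha (h h')⟩ ⟨b, fun h' => hb (h h')⟩ :=
  hr.map (SimpleGraph.induceHomOfLE G (s := (↑T : Set V)ᶜ) (s' := (↑S : Set V)ᶜ)
    (fun _ hx h' => hx (h h'))).toHom

/-- If adding `v` to `S` strictly increases the number of components, then `v` has a neighbour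
outside `S`. -/
lemma exists_nbr {V : Type*} [Fintype V] [DecidableEq V] (G : SimpleGraph V) (S : Finset V) (v : V)
    (hlt : numComp G S < numComp G (insert v S)) : ∃ w, w ∉ S ∧ G.Adj v w := by
  by_contra! hno
  refine absurd hlt (not_lt.mpr ?_)
  unfold numComp
  have key : ∀ (x y : ((↑S : Set V)ᶜ : Set V)), (G.induce ((↑S : Set V)ᶜ)).Reachable x y →
      ∀ hx : x.1 ≠ v, ∃ hy : y.1 ≠ v,
      (G.induce ((↑(insert v S) : Set V)ᶜ)).Reachable
        ⟨x.1, by simpa [hx] using fun h => x.2 h⟩ ⟨y.1, by simpa [hy] using fun h => y.2 h⟩ := by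
    rintro x y ⟨w⟩
    induction w with
    | nil => intro hx; exact ⟨hx, SimpleGraph.Reachable.refl _⟩
    | @cons a b d hab w ih =>
      intro hx
      have hadj : G.Adj a.1 b.1 := hab
      have hb : b.1 ≠ v := by
        intro hb
        have hS : a.1 ∉ S := fun h => a.2 h
        exact hno a.1 hS (hb ▸ hadj.symm)
      obtain ⟨hy, hr⟩ := ih hb
      refine ⟨hy, SimpleGraph.Reachable.trans (SimpleGraph.Adj.reachable ?_) hr⟩
      exact hadj
  refine Nat.card_le_card_of_injective (SimpleGraph.ConnectedComponent.map
    (SimpleGraph.induceHomOfLE G (s := (↑(insert v S : Finset V) : Set V)ᶜ) (s' := (↑S : Set V)ᶜ)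
    (fun _ hx h' => hx (by simp at h' ⊢; exact Or.inr h'))).toHom) ?_
  intro C D
  induction C using SimpleGraph.ConnectedComponent.ind with | _ a
  induction D using SimpleGraph.ConnectedComponent.ind with | _ b
  intro h
  rw [SimpleGraph.ConnectedComponent.map_mk, SimpleGraph.ConnectedComponent.map_mk,
    SimpleGraph.ConnectedComponent.eq] at h
  have hav : a.1 ≠ v := by
    intro h; have := a.2; simp [h] at this
  obtain ⟨_, hr⟩ := key _ _ h hav
  exact SimpleGraph.ConnectedComponent.eq.mpr hr

lemma edge_height {n : ℕ} (K : Type*) [Field K] (G : SimpleGraph (Fin n)) (S : Finset (Fin n))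
    (v : Fin n) (hv : v ∉ S) (hS : numComp G S = S.card + 1)
    (hlt : numComp G S < numComp G (insert v S)) :
    heightIdeal (PSIdeal K G S + PSIdeal K G (insert v S)) = (n : ℕ∞) := by
  classical
  haveI : Nonempty (Fin n) := ⟨v⟩
  obtain ⟨w, hwS, hvw⟩ := exists_nbr G S v hlt
  have hwv : w ≠ v := hvw.ne'
  let γ := (G.induce ((↑S : Set (Fin n))ᶜ)).ConnectedComponent
  haveI : Fintype γ := Fintype.ofFinite γ
  have hcard : Fintype.card γ = S.card + 1 := by rw [← hS, numComp, Nat.card_eq_fintype_card]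
  let c : Fin n → γ := fun i => if h : i ∈ ((↑S : Set (Fin n))ᶜ) then
    SimpleGraph.connectedComponentMk _ ⟨i, h⟩
    else SimpleGraph.connectedComponentMk _ ⟨v, by simpa using hv⟩
  have hcS : ∀ i (h : i ∈ ((↑S : Set (Fin n))ᶜ)),
      c i = SimpleGraph.connectedComponentMk _ ⟨i, h⟩ := fun i h => by simp only [c, dif_pos h]
  have hTcard : (insert v S).card = S.card + 1 := Finset.card_insert_of_notMem hv
  apply le_antisymm
  · have hbase : ∀ g : γ, ∃ b : Fin n, b ∉ insert v S ∧ c b = g := by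
      intro g
      induction g using SimpleGraph.ConnectedComponent.ind with | _ a
      by_cases hav : a.1 = v
      · refine ⟨w, by simp [hwv, hwS], ?_⟩
        rw [hcS w (by simpa using hwS), SimpleGraph.ConnectedComponent.eq]
        apply SimpleGraph.Adj.reachable
        change G.Adj w a.1
        rw [hav]; exact hvw.symm
      · have haS : a.1 ∉ S := fun h => a.2 h
        refine ⟨a.1, by simp [hav, haS], hcS _ a.2⟩
    choose b hb using hbase
    obtain ⟨q, hq1, hq2, hq3⟩ := upper_bound (K := K) (insert v S) c b hb
    have hmin : ∀ i j (hi : i ∈ ((↑S : Set (Fin n))ᶜ)) (hj : j ∈ ((↑S : Set (Fin n))ᶜ)),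
        (G.induce ((↑S : Set (Fin n))ᶜ)).Reachable ⟨i, hi⟩ ⟨j, hj⟩ →
        minorXY K i j ∈ q.asIdeal := by
      intro i j hi hj hr
      by_cases hiT : i ∈ insert v S
      · exact q.asIdeal.sub_mem (q.asIdeal.mul_mem_right _ (hq1 i hiT).1)
          (q.asIdeal.mul_mem_left _ (hq1 i hiT).2)
      by_cases hjT : j ∈ insert v S
      · exact q.asIdeal.sub_mem (q.asIdeal.mul_mem_left _ (hq1 j hjT).2)
          (q.asIdeal.mul_mem_right _ (hq1 j hjT).1)
      apply hq2 i j hiT hjT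
      rw [hcS i hi, hcS j hj, SimpleGraph.ConnectedComponent.eq]
      exact hr
    have hle : PSIdeal K G S + PSIdeal K G (insert v S) ≤ q.asIdeal := by
      refine sup_le ?_ ?_
      · refine Ideal.span_le.mpr ?_
        rintro f ((⟨t, ht, rfl⟩ | ⟨t, ht, rfl⟩) | ⟨i, j, ⟨hi, hj, hr⟩, rfl⟩)
        · exact (hq1 t (Finset.mem_insert_of_mem ht)).1
        · exact (hq1 t (Finset.mem_insert_of_mem ht)).2
        · exact hmin i j hi hj hr
      · refine Ideal.span_le.mpr ?_
        rintro f ((⟨t, ht, rfl⟩ | ⟨t, ht, rfl⟩) | ⟨i, j, ⟨hi, hj, hr⟩, rfl⟩)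
        · exact (hq1 t ht).1
        · exact (hq1 t ht).2
        · exact hmin i j _ _ (reach_mono G (Finset.subset_insert v S) hi hj hr)
    refine (iInf₂_le q hle).trans ?_
    rw [hcard, hTcard, Fintype.card_fin, Nat.cast_add n] at hq3
    exact (ENat.add_le_add_iff_right (ENat.coe_ne_top _)).mp hq3
  · refine le_iInf₂ fun p hp => ?_
    have hpS : PSIdeal K G S ≤ p.asIdeal := le_sup_left.trans hp
    have hpT : PSIdeal K G (insert v S) ≤ p.asIdeal := le_sup_right.trans hp
    have := lower_bound (K := K) p.asIdeal (insert v S) c ?_ ?_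
    · rw [hcard, hTcard, Fintype.card_fin, Nat.cast_add n] at this
      exact (ENat.add_le_add_iff_right (ENat.coe_ne_top _)).mp this
    · intro t ht
      exact ⟨hpT (Ideal.subset_span (Or.inl (Or.inl ⟨t, ht, rfl⟩))),
        hpT (Ideal.subset_span (Or.inl (Or.inr ⟨t, ht, rfl⟩)))⟩
    · intro i j hi hj hij
      have hi' : i ∈ ((↑S : Set (Fin n))ᶜ) := fun h => hi (Finset.mem_insert_of_mem h)
      have hj' : j ∈ ((↑S : Set (Fin n))ᶜ) := fun h => hj (Finset.mem_insert_of_mem h)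
      rw [hcS i hi', hcS j hj', SimpleGraph.ConnectedComponent.eq] at hij
      exact hpS (Ideal.subset_span (Or.inr ⟨i, j, ⟨hi', hj', hij⟩, rfl⟩))

lemma card_add_numComp_le {n : ℕ} (G : SimpleGraph (Fin n)) (S : Finset (Fin n)) :
    S.card + numComp G S ≤ n := by
  have h1 : numComp G S ≤ Nat.card ((↑S : Set (Fin n))ᶜ : Set (Fin n)) :=
    Nat.card_le_card_of_surjective (SimpleGraph.connectedComponentMk _) Quot.mk_surjective
  have h2 : Nat.card ((↑S : Set (Fin n))ᶜ : Set (Fin n)) = Sᶜ.card := by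
    rw [← Finset.coe_compl, Nat.card_coe_set_eq, Set.ncard_coe_finset]
  have h3 := Finset.card_add_card_compl S
  rw [Fintype.card_fin] at h3
  omega

lemma edist_empty_le {n : ℕ} (K : Type*) [Field K] (G : SimpleGraph (Fin n))
    (hunmixed : Unmixed G)
    (hdrop : ∀ S : Finset (Fin n), IsCutSet G S → S ≠ ∅ →
      ∃ s ∈ S, IsCutSet G (S.erase s)) (k : ℕ) :
    ∀ S : {S : Finset (Fin n) // IsCutSet G S}, S.1.card = k →
      (dualGraph K G).edist S ⟨∅, Or.inl rfl⟩ ≤ k := by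
  induction k with
  | zero =>
    rintro ⟨S, hS⟩ h
    have : S = ∅ := Finset.card_eq_zero.mp h
    subst this
    simp
  | succ k ih =>
    rintro ⟨S, hS⟩ h
    have hne : S ≠ ∅ := by rintro rfl; simp at h
    obtain ⟨s, hs, hcut⟩ := hdrop S hS hne
    have hlt : numComp G (S.erase s) < numComp G S := (hS.resolve_left hne).2 s hs
    have hk : (S.erase s).card = k := by
      rw [Finset.card_erase_of_mem hs]; simp at h; omega
    have hadj : (dualGraph K G).Adj ⟨S, hS⟩ ⟨S.erase s, hcut⟩ := by
      rw [dualGraph, SimpleGraph.fromRel_adj]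
      refine ⟨?_, Or.inr ?_⟩
      · intro he
        rw [← Subtype.mk.inj he] at hlt
        exact lt_irrefl _ hlt
      · have := edge_height K G (S.erase s) s (Finset.notMem_erase s S) (hunmixed _ hcut)
          (by rwa [Finset.insert_erase hs])
        rwa [Finset.insert_erase hs] at this
    refine SimpleGraph.edist_triangle.trans
      (add_le_add (SimpleGraph.edist_eq_one_iff_adj.mpr hadj).le (ih ⟨_, hcut⟩ hk)) |>.trans ?_
    push_cast
    rw [add_comm]

theorem stmt19 {n : ℕ} (K : Type*) [Field K] (G : SimpleGraph (Fin n))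
    (hn : 3 ≤ n) (hconn : G.Connected)
    (V1 V2 : Finset (Fin n)) (hdisj : Disjoint V1 V2) (hcover : V1 ∪ V2 = Finset.univ)
    (hbip : ∀ a b, G.Adj a b → (a ∈ V1 ∧ b ∈ V2) ∨ (a ∈ V2 ∧ b ∈ V1))
    (hunmixed : Unmixed G)
    (hdrop : ∀ S : Finset (Fin n), IsCutSet G S → S ≠ ∅ →
      ∃ s ∈ S, IsCutSet G (S.erase s)) :
    (∀ S : Finset (Fin n), IsCutSet G S → S.card ≤ (n + 1) / 2 - 1) ∧
    (dualGraph K G).diam ≤ n - 1 := by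
  have hcard : ∀ S : Finset (Fin n), IsCutSet G S → S.card ≤ (n + 1) / 2 - 1 := by
    intro S hS
    have h1 := card_add_numComp_le G S
    rw [hunmixed S hS] at h1
    omega
  refine ⟨hcard, ?_⟩
  have hed : (dualGraph K G).ediam ≤ ((n - 1 : ℕ) : ℕ∞) := by
    refine SimpleGraph.ediam_le_of_edist_le fun S T => ?_
    have hS := edist_empty_le K G hunmixed hdrop _ S rfl
    have hT := edist_empty_le K G hunmixed hdrop _ T rfl
    rw [SimpleGraph.edist_comm] at hT
    refine (SimpleGraph.edist_triangle.trans (add_le_add hS hT)).trans ?_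
    have h1 := hcard _ S.2
    have h2 := hcard _ T.2
    norm_cast
    omega
  exact ENat.toNat_le_of_le_coe hed
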